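/- Let λ₁, …, λ_n be distinct points in 𝔻 and let (x_{1j}, x_{2j}, x_{3j}) ∈ Ē satisfy x_{1j}x_{2j} ≠ x_{3j} for j = 1,…,n. The following are equivalent: (i) there exists an analytic map x : 𝔻 → Ē with x(λⱼ) = (x_{1j}, x_{2j}, x_{3j}) for j = 1,…,n; (iii) for every triple of distinct points z₁, z₂, z₃ ∈ 𝔻 there exist positive semidefinite 3n×3n complex matrices N = [N_{il,jk}] of rank at most 1 and M = [M_{il,jk}] (indexed by pairs (i,l), (j,k) with 1 ≤ i,j ≤ n, 1 ≤ l,k ≤ 3) such that for all i, j, l, k: 1 − conj((z_l x_{3i} − x_{1i})/(x_{2i}z_l − 1))·(z_k x_{3j} − x_{1j})/(x_{2j}z_k − 1) = (1 − conj(z_l)z_k)·N_{il,jk} + (1 − conj(λᵢ)λⱼ)·M_{il,jk}; (iv) for some triple of distinct points z₁, z₂, z₃ ∈ 𝔻 there exist positive semidefinite 3n×3n complex matrices N of rank at most 1 and M such that the 3n×3n matrix with ((i,l),(j,k)) entry 1 − conj((z_l x_{3i} − x_{1i})/(x_{2i}z_l − 1))·(z_k x_{3j} − x_{1j})/(x_{2j}z_k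 − 1) − (1 − conj(z_l)z_k)·N_{il,jk} − (1 − conj(λᵢ)λⱼ)·M_{il,jk} is positive semidefinite. -/

import Mathlib

open Complex Metric Matrix
open scoped ComplexOrder

noncomputable section

/-- The open unit disc in ℂ. -/
def uDisc : Set ℂ := Metric.ball 0 1

/-- The closed tetrablock Ē ⊂ ℂ³. -/
def closedTetra : Set (ℂ × ℂ × ℂ) :=
  {x | ∀ z ∈ uDisc, ∀ w ∈ uDisc, 1 - x.1 * z - x.2.1 * w + x.2.2 * z * w ≠ 0}

/-- Hol(𝔻,Ē): analytic maps of the disc into the closed tetrablock. -/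
def HolDiscTetra (x : ℂ → ℂ × ℂ × ℂ) : Prop :=
  AnalyticOnNhd ℂ x uDisc ∧ ∀ l ∈ uDisc, x l ∈ closedTetra

/-- The matrix `[a b; c d]` is a contraction of the Hilbert space `ℂ²`. -/
def IsContraction₂ (a b c d : ℂ) : Prop :=
  ∀ s t : ℂ, ‖a * s + b * t‖ ^ 2 + ‖c * s + d * t‖ ^ 2 ≤ ‖s‖ ^ 2 + ‖t‖ ^ 2

lemma mem_uDisc {z : ℂ} : z ∈ uDisc ↔ ‖z‖ < 1 := by simp [uDisc]

lemma IsContraction₂.norm_left_sq_add_le {a b c d : ℂ} (h : IsContraction₂ a b c d) :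
    ‖a‖ ^ 2 + ‖c‖ ^ 2 ≤ 1 := by
  simpa using h 1 0

lemma one_sub_mul_ne_zero {a z : ℂ} (ha : ‖a‖ ≤ 1) (hz : ‖z‖ < 1) : 1 - a * z ≠ 0 := by
  intro h
  have h1 : ‖a * z‖ = 1 := by rw [← sub_eq_zero.mp h, norm_one]
  rw [norm_mul] at h1
  nlinarith [norm_nonneg a, norm_nonneg z]

lemma IsContraction₂.mem_closedTetra {a b c d : ℂ} (h : IsContraction₂ a b c d) :
    (a, d, a * d - b * c) ∈ closedTetra := by
  intro z hz w hw h0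
  rw [mem_uDisc] at hz hw
  simp only at h0
  have ha : ‖a‖ ≤ 1 := by nlinarith [h.norm_left_sq_add_le, sq_nonneg ‖c‖, norm_nonneg a]
  have haz := one_sub_mul_ne_zero ha hz
  have key := h (z * (b * w)) (w * (1 - a * z))
  rw [show a * (z * (b * w)) + b * (w * (1 - a * z)) = b * w by ring,
    show c * (z * (b * w)) + d * (w * (1 - a * z)) = 1 - a * z by linear_combination -h0,
    norm_mul z, norm_mul w (1 - a * z), mul_pow, mul_pow] at key
  have hpos : 0 < ‖1 - a * z‖ ^ 2 := by positivity
  have hz2 : ‖z‖ ^ 2 ≤ 1 := by nlinarith [norm_nonneg z]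
  have hw2 : ‖w‖ ^ 2 < 1 := by nlinarith [norm_nonneg w]
  nlinarith [sq_nonneg ‖b * w‖]

/-- Douglas-type lemma: domination of linear combinations is implemented by a contraction. -/
lemma exists_contraction_of_norm_sum_le {E ι : Type*} [NormedAddCommGroup E]
    [InnerProductSpace ℂ E] [FiniteDimensional ℂ E] [Fintype ι] (a b : ι → E)
    (h : ∀ c : ι → ℂ, ‖∑ i, c i • b i‖ ≤ ‖∑ i, c i • a i‖) :
    ∃ L : E →L[ℂ] E, (∀ v, ‖L v‖ ≤ ‖v‖) ∧ ∀ i, L (a i) = b i := by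
  classical
  let T := Fintype.linearCombination ℂ a
  let S := Fintype.linearCombination ℂ b
  have hTS : LinearMap.ker T ≤ LinearMap.ker S := by
    intro c hc
    have hc' : ∑ i, c i • a i = 0 := hc
    have := h c
    rw [hc', norm_zero] at this
    exact norm_le_zero_iff.mp this
  let K := LinearMap.range T
  let e := T.quotKerEquivRange
  let g : K →ₗ[ℂ] E := ((LinearMap.ker T).liftQ S hTS).comp e.symm.toLinearMap
  have hg : ∀ c, g ⟨T c, LinearMap.mem_range_self T c⟩ = S c := by
    intro c
    have : e ((LinearMap.ker T).mkQ c) = ⟨T c, LinearMap.mem_range_self T c⟩ := rfl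
    simp only [g, LinearMap.comp_apply, LinearEquiv.coe_coe]
    rw [← this, LinearEquiv.symm_apply_apply]
    rfl
  refine ⟨(LinearMap.toContinuousLinearMap g).comp K.orthogonalProjectionOnto, fun v => ?_,
    fun i => ?_⟩
  · obtain ⟨c, hc⟩ := (K.orthogonalProjectionOnto v).2
    have hc' : K.orthogonalProjectionOnto v = ⟨T c, LinearMap.mem_range_self T c⟩ :=
      Subtype.ext hc.symm
    calc ‖g (K.orthogonalProjectionOnto v)‖ = ‖S c‖ := by rw [hc', hg]
      _ ≤ ‖T c‖ := h c
      _ = ‖K.orthogonalProjectionOnto v‖ := by rw [hc']; rfl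
      _ ≤ ‖v‖ := K.norm_orthogonalProjectionOnto_apply_le v
  · have hT : T (Pi.single i 1) = a i := by
      simp [T, Fintype.linearCombination_apply_single]
    have hS : S (Pi.single i 1) = b i := by
      simp [S, Fintype.linearCombination_apply_single]
    have hmem : a i ∈ K := ⟨_, hT⟩
    have hp : K.orthogonalProjectionOnto (a i) =
        ⟨T (Pi.single i 1), LinearMap.mem_range_self T _⟩ := by
      apply Subtype.ext
      change _ = T (Pi.single i 1)
      rw [hT]
      exact Submodule.starProjection_eq_self_iff.mpr hmem
    change g (K.orthogonalProjectionOnto (a i)) = b i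
    rw [hp, hg, hS]

/-- The Hilbert space `ℂ² ⊕ ℂ^κ`. -/
abbrev StateSpace (κ : Type*) := EuclideanSpace ℂ (Fin 2 ⊕ κ)

/-- The vector `(s, t, m)` of `ℂ² ⊕ ℂ^κ`. -/
def stateVec {κ : Type*} (s t : ℂ) (m : κ → ℂ) : StateSpace κ :=
  WithLp.toLp 2 (Sum.elim ![s, t] m)

section StateSpace

variable {κ : Type*}

@[simp] lemma stateVec_zero (s t : ℂ) (m : κ → ℂ) : stateVec s t m (Sum.inl 0) = s := rfl

@[simp] lemma stateVec_one (s t : ℂ) (m : κ → ℂ) : stateVec s t m (Sum.inl 1) = t := rfl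

@[simp] lemma stateVec_inr (s t : ℂ) (m : κ → ℂ) (r : κ) : stateVec s t m (Sum.inr r) = m r := rfl

lemma StateSpace.ext {u v : StateSpace κ} (h0 : u (Sum.inl 0) = v (Sum.inl 0))
    (h1 : u (Sum.inl 1) = v (Sum.inl 1)) (h : ∀ r, u (Sum.inr r) = v (Sum.inr r)) : u = v := by
  ext i
  rcases i with i | i
  · fin_cases i
    exacts [h0, h1]
  · exact h i

variable [Fintype κ]

lemma StateSpace.norm_sq_eq (v : StateSpace κ) :
    ‖v‖ ^ 2 = ‖v (Sum.inl 0)‖ ^ 2 + ‖v (Sum.inl 1)‖ ^ 2 + ∑ r, ‖v (Sum.inr r)‖ ^ 2 := by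
  simp [EuclideanSpace.norm_sq_eq, Fintype.sum_sum_type, Fin.sum_univ_two]

/-- The orthogonal projection of `ℂ² ⊕ ℂ^κ` onto `ℂ^κ`. -/
def stateProj (κ : Type*) [Fintype κ] : StateSpace κ →L[ℂ] StateSpace κ :=
  LinearMap.toContinuousLinearMap
    { toFun := fun v => stateVec 0 0 (fun r => v (Sum.inr r))
      map_add' := fun u v => StateSpace.ext (by simp) (by simp) (by simp)
      map_smul' := fun k v => StateSpace.ext (by simp) (by simp) (by simp) }

lemma stateProj_apply (v : StateSpace κ) :
    stateProj κ v = stateVec 0 0 (fun r => v (Sum.inr r)) := rfl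

lemma norm_stateProj_apply_le (v : StateSpace κ) : ‖stateProj κ v‖ ≤ ‖v‖ := by
  rw [← sq_le_sq₀ (norm_nonneg _) (norm_nonneg _), StateSpace.norm_sq_eq,
    StateSpace.norm_sq_eq v, stateProj_apply]
  simp only [stateVec_zero, stateVec_one, stateVec_inr, norm_zero]
  have := sq_nonneg ‖v (Sum.inl 0)‖
  have := sq_nonneg ‖v (Sum.inl 1)‖
  linarith

/-- The pencil `1 - l P L`, with `P` the projection onto `ℂ^κ`. -/
def statePencil (L : StateSpace κ →L[ℂ] StateSpace κ) (l : ℂ) : StateSpace κ →L[ℂ] StateSpace κ :=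
  1 - l • (stateProj κ).comp L

lemma statePencil_apply (L : StateSpace κ →L[ℂ] StateSpace κ) (l : ℂ) (y : StateSpace κ) :
    statePencil L l y = y - l • stateProj κ (L y) := rfl

lemma isUnit_statePencil {L : StateSpace κ →L[ℂ] StateSpace κ} (hL : ∀ v, ‖L v‖ ≤ ‖v‖) {l : ℂ}
    (hl : l ∈ uDisc) : IsUnit (statePencil L l) := by
  have hT : ‖(stateProj κ).comp L‖ ≤ 1 :=
    ContinuousLinearMap.opNorm_le_bound _ zero_le_one fun v => by
      rw [one_mul]; exact (norm_stateProj_apply_le _).trans (hL v)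
  rw [mem_uDisc] at hl
  apply isUnit_one_sub_of_norm_lt_one
  rw [norm_smul]
  nlinarith [norm_nonneg l, norm_nonneg ((stateProj κ).comp L)]

/-- The solution `y` of `y = (s, t, 0) + l P L y`. -/
def stateSolution (L : StateSpace κ →L[ℂ] StateSpace κ) (s t l : ℂ) : StateSpace κ :=
  Ring.inverse (statePencil L l) (stateVec s t 0)

variable {L : StateSpace κ →L[ℂ] StateSpace κ}

lemma stateSolution_eq (hL : ∀ v, ‖L v‖ ≤ ‖v‖) {s t l : ℂ} (hl : l ∈ uDisc) :
    stateSolution L s t l = stateVec s t (fun r => l * L (stateSolution L s t l) (Sum.inr r)) := by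
  have h : statePencil L l (stateSolution L s t l) = stateVec s t 0 := by
    rw [stateSolution, ← mul_apply_eq_comp,
      Ring.mul_inverse_cancel _ (isUnit_statePencil hL hl)]
    rfl
  rw [statePencil_apply, sub_eq_iff_eq_add, stateProj_apply] at h
  conv_lhs => rw [h]
  exact StateSpace.ext (by simp) (by simp) (by simp)

lemma stateSolution_unique (hL : ∀ v, ‖L v‖ ≤ ‖v‖) {s t s' t' l : ℂ} {m : κ → ℂ} (hl : l ∈ uDisc)
    (h : L (stateVec s t (l • m)) = stateVec s' t' m) :
    stateSolution L s t l = stateVec s t (l • m) := by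
  have h1 : statePencil L l (stateVec s t (l • m)) = stateVec s t 0 := by
    rw [statePencil_apply, h, stateProj_apply]
    exact StateSpace.ext (by simp) (by simp) (by simp)
  rw [stateSolution, ← h1, ← mul_apply_eq_comp,
    Ring.inverse_mul_cancel _ (isUnit_statePencil hL hl)]
  rfl

lemma differentiableOn_stateSolution (hL : ∀ v, ‖L v‖ ≤ ‖v‖) (s t : ℂ) (i : Fin 2 ⊕ κ) :
    DifferentiableOn ℂ (fun l => L (stateSolution L s t l) i) uDisc := by
  intro l hl
  have h1 : DifferentiableAt ℂ (fun l => Ring.inverse (statePencil L l)) l := by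
    have h2 : DifferentiableAt ℂ (Ring.inverse : (StateSpace κ →L[ℂ] StateSpace κ) → _)
        (statePencil L l) := differentiableAt_inverse (isUnit_statePencil hL hl)
    have h3 : DifferentiableAt ℂ (statePencil L) l :=
      (differentiableAt_const _).sub (differentiableAt_id.smul_const _)
    exact h2.comp l h3
  have h2 : DifferentiableAt ℂ (fun l => L (stateSolution L s t l)) l :=
    L.differentiableAt.comp l (h1.clm_apply (differentiableAt_const _))
  exact (((EuclideanSpace.proj (𝕜 := ℂ) i).differentiableAt).comp l h2).differentiableWithinAt

/-- The transfer function of a contractive colligation is a contraction at every point of the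
disc. -/
lemma exists_transfer_function (hL : ∀ v, ‖L v‖ ≤ ‖v‖) :
    ∃ a b c d : ℂ → ℂ, DifferentiableOn ℂ a uDisc ∧ DifferentiableOn ℂ b uDisc ∧
      DifferentiableOn ℂ c uDisc ∧ DifferentiableOn ℂ d uDisc ∧
      (∀ l ∈ uDisc, IsContraction₂ (a l) (b l) (c l) (d l)) ∧
      ∀ l ∈ uDisc, ∀ (s t s' t' : ℂ) (m : κ → ℂ),
        L (stateVec s t (l • m)) = stateVec s' t' m →
        a l * s + b l * t = s' ∧ c l * s + d l * t = t' := by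
  have hlin : ∀ l s t i, L (stateSolution L 1 0 l) i * s + L (stateSolution L 0 1 l) i * t =
      L (stateSolution L s t l) i := by
    intro l s t i
    have h : (stateVec s t 0 : StateSpace κ) = s • stateVec 1 0 0 + t • stateVec 0 1 0 :=
      StateSpace.ext (by simp) (by simp) (by simp)
    rw [stateSolution, stateSolution, stateSolution, h, map_add, map_smul, map_smul, map_add,
      map_smul, map_smul, PiLp.add_apply, PiLp.smul_apply, PiLp.smul_apply, smul_eq_mul,
      smul_eq_mul, mul_comm s, mul_comm t]
  refine ⟨fun l => L (stateSolution L 1 0 l) (Sum.inl 0),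
    fun l => L (stateSolution L 0 1 l) (Sum.inl 0), fun l => L (stateSolution L 1 0 l) (Sum.inl 1),
    fun l => L (stateSolution L 0 1 l) (Sum.inl 1), differentiableOn_stateSolution hL _ _ _,
    differentiableOn_stateSolution hL _ _ _, differentiableOn_stateSolution hL _ _ _,
    differentiableOn_stateSolution hL _ _ _, fun l hl s t => ?_, fun l hl s t s' t' m hm => ?_⟩
  · rw [hlin, hlin]
    have h1 := hL (stateSolution L s t l)
    have hy := stateSolution_eq hL (s := s) (t := t) hl
    set y := stateSolution L s t l
    rw [← sq_le_sq₀ (norm_nonneg _) (norm_nonneg _), StateSpace.norm_sq_eq] at h1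
    have h3 : ‖y‖ ^ 2 = ‖s‖ ^ 2 + ‖t‖ ^ 2 + ∑ r, ‖l * (L y) (Sum.inr r)‖ ^ 2 := by
      conv_lhs => rw [hy]
      rw [StateSpace.norm_sq_eq]
      simp only [stateVec_zero, stateVec_one, stateVec_inr]
    have h2 : ∑ r, ‖l * (L y) (Sum.inr r)‖ ^ 2 ≤ ∑ r, ‖(L y) (Sum.inr r)‖ ^ 2 := by
      refine Finset.sum_le_sum fun r _ => ?_
      rw [norm_mul]
      have := (mem_uDisc.mp hl).le
      gcongr
      exact mul_le_of_le_one_left (norm_nonneg _) this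
    linarith
  · rw [hlin, hlin, stateSolution_unique hL hl hm, hm]
    exact ⟨rfl, rfl⟩

end StateSpace

lemma Matrix.PosSemidef.exists_conjTranspose_mul_self {ι : Type*} [Fintype ι]
    {M : Matrix ι ι ℂ} (hM : M.PosSemidef) : ∃ B : Matrix ι ι ℂ, M = Bᴴ * B := by
  classical
  open scoped MatrixOrder in
  obtain ⟨B, hB⟩ := CStarAlgebra.nonneg_iff_eq_star_mul_self.mp hM.nonneg
  exact ⟨B, hB⟩

/-- A positive semidefinite matrix of rank at most one is of the form `γ* γ` for a row `γ`. -/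
lemma Matrix.PosSemidef.exists_eq_star_mul_of_rank_le_one {ι : Type*} [Fintype ι]
    {N : Matrix ι ι ℂ} (hN : N.PosSemidef) (hr : N.rank ≤ 1) :
    ∃ γ : ι → ℂ, ∀ p q, N p q = star (γ p) * γ q := by
  classical
  obtain ⟨B, rfl⟩ := hN.exists_conjTranspose_mul_self
  rw [rank_conjTranspose_mul_self] at hr
  obtain ⟨v, hv⟩ := finrank_le_one_iff.mp hr
  have hcol : ∀ q, ∃ c : ℂ, c • (v : ι → ℂ) = fun r => B r q := by
    intro q
    obtain ⟨c, hc⟩ := hv ⟨B.mulVecLin (Pi.single q 1), LinearMap.mem_range_self _ _⟩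
    refine ⟨c, ?_⟩
    have := congrArg Subtype.val hc
    simp only [mulVecLin_apply, mulVec_single_one] at this
    exact this
  choose c hc using hcol
  set w : ι → ℂ := (v : ι → ℂ)
  refine ⟨fun q => (Real.sqrt (∑ r, ‖w r‖ ^ 2) : ℂ) * c q, fun p q => ?_⟩
  have hB : ∀ r q, B r q = c q * w r := fun r q => (congrFun (hc q) r).symm
  have hs : ((Real.sqrt (∑ r, ‖w r‖ ^ 2) : ℂ)) * (Real.sqrt (∑ r, ‖w r‖ ^ 2) : ℂ)
      = ∑ r, star (w r) * w r := by
    rw [← Complex.ofReal_mul, Real.mul_self_sqrt (by positivity)]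
    push_cast
    exact Finset.sum_congr rfl fun r _ => (Complex.conj_mul' _).symm
  simp only [mul_apply, conjTranspose_apply, hB, star_mul']
  rw [show star (Real.sqrt (∑ r, ‖w r‖ ^ 2) : ℂ) = (Real.sqrt (∑ r, ‖w r‖ ^ 2) : ℂ) from
    Complex.conj_ofReal _]
  calc ∑ r, star (c p) * star (w r) * (c q * w r)
      = star (c p) * c q * ∑ r, star (w r) * w r := by
        rw [Finset.mul_sum]; exact Finset.sum_congr rfl fun r _ => by ring
    _ = _ := by rw [← hs]; ring

lemma norm_sum_smul_sq {E ι : Type*} [NormedAddCommGroup E] [InnerProductSpace ℂ E] [Fintype ι]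
    (a : ι → E) (c : ι → ℂ) :
    ‖∑ i, c i • a i‖ ^ 2 = (∑ p, ∑ q, star (c p) * inner ℂ (a p) (a q) * c q).re := by
  rw [← inner_self_eq_norm_sq (𝕜 := ℂ), sum_inner]
  simp only [inner_sum, inner_smul_left, inner_smul_right]
  change Complex.re _ = _
  congr 1
  refine Finset.sum_congr rfl fun p _ => Finset.sum_congr rfl fun q _ => ?_
  rw [starRingEnd_apply]
  ring

lemma star_dotProduct_mulVec_eq_sum {ι : Type*} [Fintype ι] (A : Matrix ι ι ℂ) (c : ι → ℂ) :
    star c ⬝ᵥ (A *ᵥ c) = ∑ p, ∑ q, star (c p) * A p q * c q := by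
  simp [dotProduct, mulVec, Finset.mul_sum, mul_assoc]

lemma inner_stateVec {κ : Type*} [Fintype κ] (s t s' t' : ℂ) (m m' : κ → ℂ) :
    inner ℂ (stateVec s t m) (stateVec s' t' m') =
      star s * s' + star t * t' + ∑ r, star (m r) * m' r := by
  simp [PiLp.inner_apply, Fintype.sum_sum_type, Fin.sum_univ_two, stateVec, mul_comm]

lemma tetra_eq_of_linearFractional_eq {x1 x2 x3 a d D : ℂ} (hne : x1 * x2 ≠ x3) (zs : Fin 3 → ℂ)
    (hz : Function.Injective zs)
    (h : ∀ k, (x1 - x3 * zs k) * (1 - d * zs k) = (a - D * zs k) * (1 - x2 * zs k)) :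
    (a, d, D) = (x1, x2, x3) := by
  have h01 : zs 0 - zs 1 ≠ 0 := sub_ne_zero.mpr (hz.ne (by decide))
  have h02 : zs 0 - zs 2 ≠ 0 := sub_ne_zero.mpr (hz.ne (by decide))
  have h12 : zs 1 - zs 2 ≠ 0 := sub_ne_zero.mpr (hz.ne (by decide))
  have e0 := h 0
  have e1 := h 1
  have e2 := h 2
  generalize zs 0 = u at *
  generalize zs 1 = v at *
  generalize zs 2 = w at *
  have f01 : (x3 * d - D * x2) * (u + v) - (x3 + x1 * d - D - a * x2) = 0 :=
    mul_left_cancel₀ h01 (by linear_combination e0 - e1)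
  have f02 : (x3 * d - D * x2) * (u + w) - (x3 + x1 * d - D - a * x2) = 0 :=
    mul_left_cancel₀ h02 (by linear_combination e0 - e2)
  have q2 : x3 * d - D * x2 = 0 :=
    mul_left_cancel₀ h12 (by linear_combination f01 - f02)
  have q1 : x3 + x1 * d - D - a * x2 = 0 := by
    linear_combination -f01 + (u + v) * q2
  have q0 : a = x1 := by linear_combination u ^ 2 * q2 - u * q1 - e0
  subst q0
  have hd : d = x2 :=
    mul_left_cancel₀ (sub_ne_zero.mpr hne) (by linear_combination -q2 + x2 * q1)
  subst hd
  have hD : D = x3 := by linear_combination -q1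
  rw [hD]

lemma closedTetra.one_sub_mul_ne_zero {x : ℂ × ℂ × ℂ} (hx : x ∈ closedTetra) {z : ℂ}
    (hz : z ∈ uDisc) : 1 - x.2.1 * z ≠ 0 := by
  simpa using hx 0 (by simp [uDisc]) z hz

/-- The lurking isometry argument: a dominated Pick decomposition produces an interpolating
function. -/
lemma exists_interpolant_of_posSemidef {n : ℕ} {lam : Fin n → ℂ} (hlam : ∀ j, lam j ∈ uDisc)
    {x1 x2 x3 : Fin n → ℂ} (hE : ∀ j, (x1 j, x2 j, x3 j) ∈ closedTetra)
    (hne : ∀ j, x1 j * x2 j ≠ x3 j) {zs : Fin 3 → ℂ} (hzs : ∀ k, zs k ∈ uDisc)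
    (hinj : Function.Injective zs) {N M : Matrix (Fin n × Fin 3) (Fin n × Fin 3) ℂ}
    (hN : N.PosSemidef) (hr : N.rank ≤ 1) (hM : M.PosSemidef)
    (hP : (Matrix.of fun p q : Fin n × Fin 3 =>
            1 - star ((zs p.2 * x3 p.1 - x1 p.1) / (x2 p.1 * zs p.2 - 1)) *
                  ((zs q.2 * x3 q.1 - x1 q.1) / (x2 q.1 * zs q.2 - 1)) -
              (1 - star (zs p.2) * zs q.2) * N p q -
                (1 - star (lam p.1) * lam q.1) * M p q).PosSemidef) :
    ∃ x : ℂ → ℂ × ℂ × ℂ, HolDiscTetra x ∧ ∀ j, x (lam j) = (x1 j, x2 j, x3 j) := by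
  obtain ⟨γ, hγ⟩ := hN.exists_eq_star_mul_of_rank_le_one hr
  obtain ⟨B, hB⟩ := hM.exists_conjTranspose_mul_self
  set Ψ : Fin n × Fin 3 → ℂ :=
    fun q => (zs q.2 * x3 q.1 - x1 q.1) / (x2 q.1 * zs q.2 - 1) with hΨ
  let u : Fin n × Fin 3 → StateSpace (Fin n × Fin 3) :=
    fun q => stateVec 1 (zs q.2 * γ q) (lam q.1 • fun r => B r q)
  let v : Fin n × Fin 3 → StateSpace (Fin n × Fin 3) :=
    fun q => stateVec (Ψ q) (γ q) (fun r => B r q)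
  have hdom : ∀ c : Fin n × Fin 3 → ℂ, ‖∑ i, c i • v i‖ ≤ ‖∑ i, c i • u i‖ := by
    intro c
    rw [← sq_le_sq₀ (norm_nonneg _) (norm_nonneg _), norm_sum_smul_sq, norm_sum_smul_sq,
      ← sub_nonneg, ← Complex.sub_re, ← Finset.sum_sub_distrib]
    have h := (Complex.nonneg_iff.mp (hP.dotProduct_mulVec_nonneg c)).1
    rw [star_dotProduct_mulVec_eq_sum] at h
    refine h.trans_eq (congrArg Complex.re ?_)
    refine Finset.sum_congr rfl fun p _ => ?_
    rw [← Finset.sum_sub_distrib]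
    refine Finset.sum_congr rfl fun q _ => ?_
    have hMs : M p q = ∑ r, star (B r p) * B r q := by
      rw [hB]; simp [mul_apply]
    have hMs' : ∑ r, star ((lam p.1 • fun r => B r p) r) * (lam q.1 • fun r => B r q) r
        = star (lam p.1) * lam q.1 * M p q := by
      rw [hMs, Finset.mul_sum]
      refine Finset.sum_congr rfl fun r _ => ?_
      simp only [Pi.smul_apply, smul_eq_mul, star_mul']
      ring
    simp only [u, v, inner_stateVec, of_apply]
    rw [hMs', ← hMs, hγ]
    simp only [star_one, star_mul', hΨ]
    ring
  obtain ⟨L, hL, hLu⟩ := exists_contraction_of_norm_sum_le u v hdom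
  obtain ⟨a, b, c, d, ha, hb, hc, hd, hF, hI⟩ := exists_transfer_function hL
  refine ⟨fun l => (a l, d l, a l * d l - b l * c l), ⟨?_, fun l hl => (hF l hl).mem_closedTetra⟩,
    fun j => ?_⟩
  · have ho : IsOpen uDisc := isOpen_ball
    exact (ha.prodMk (hd.prodMk ((ha.mul hd).sub (hb.mul hc)))).analyticOnNhd ho
  · refine tetra_eq_of_linearFractional_eq (hne j) zs hinj fun k => ?_
    obtain ⟨h1, h2⟩ := hI (lam j) (hlam j) _ _ _ _ _ (hLu (j, k))
    have hx := closedTetra.one_sub_mul_ne_zero (hE j) (hzs k)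
    have hx' : x2 j * zs k - 1 ≠ 0 := by
      rw [← neg_ne_zero]; simpa using hx
    have hΨ' : Ψ (j, k) * (x2 j * zs k - 1) = zs k * x3 j - x1 j := by
      exact div_mul_cancel₀ _ hx'
    clear_value Ψ
    dsimp only at h1 h2
    linear_combination (1 - d (lam j) * zs k) * hΨ' +
      (1 - d (lam j) * zs k) * (1 - x2 j * zs k) * (-h1) +
      b (lam j) * zs k * (1 - x2 j * zs k) * (-h2)

lemma exists_norm_eq_one_mul_eq_norm (e : ℂ) : ∃ u : ℂ, ‖u‖ = 1 ∧ u * e = ‖e‖ := by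
  by_cases he : e = 0
  · exact ⟨1, norm_one, by simp [he]⟩
  · have h : ‖e‖ ≠ 0 := norm_ne_zero_iff.mpr he
    have h' : (‖e‖ : ℂ) ≠ 0 := by exact_mod_cast h
    refine ⟨(starRingEnd ℂ) e / ‖e‖, by simp [h], ?_⟩
    rw [div_mul_eq_mul_div, Complex.conj_mul', sq, mul_div_assoc, div_self h', mul_one]

lemma norm_sub_mul_le_of_mem_closedTetra {x1 x2 x3 : ℂ} (hx : (x1, x2, x3) ∈ closedTetra) {w : ℂ}
    (hw : ‖w‖ ≤ 1) : ‖x1 - x3 * w‖ ≤ ‖1 - x2 * w‖ := by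
  have hball : ∀ v ∈ ball (0 : ℂ) 1, ‖x1 - x3 * v‖ ≤ ‖1 - x2 * v‖ := by
    intro v hv
    by_contra! h
    have h0 : x1 - x3 * v ≠ 0 := norm_pos_iff.mp ((norm_nonneg _).trans_lt h)
    refine hx ((1 - x2 * v) / (x1 - x3 * v)) ?_ v hv ?_
    · rw [mem_uDisc, norm_div, div_lt_one (norm_pos_iff.mpr h0)]
      exact h
    · have := div_mul_cancel₀ (1 - x2 * v) h0
      simp only
      linear_combination -this
  have hcl : IsClosed {v : ℂ | ‖x1 - x3 * v‖ ≤ ‖1 - x2 * v‖} :=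
    isClosed_le (by fun_prop) (by fun_prop)
  have := closure_minimal hball hcl
  rw [closure_ball (0 : ℂ) one_ne_zero] at this
  exact this (by simpa using hw)

lemma closedTetra.swap {x1 x2 x3 : ℂ} (hx : (x1, x2, x3) ∈ closedTetra) :
    (x2, x1, x3) ∈ closedTetra := by
  intro z hz w hw h
  refine hx w hw z hz ?_
  simp only at h ⊢
  linear_combination h

lemma two_mul_norm_sub_le_of_mem_closedTetra {x1 x2 x3 : ℂ} (hx : (x1, x2, x3) ∈ closedTetra) :
    2 * ‖x2 - (starRingEnd ℂ) x1 * x3‖ ≤ 1 + ‖x2‖ ^ 2 - ‖x1‖ ^ 2 - ‖x3‖ ^ 2 := by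
  obtain ⟨u, hu, hue⟩ := exists_norm_eq_one_mul_eq_norm (x2 - (starRingEnd ℂ) x1 * x3)
  have h := norm_sub_mul_le_of_mem_closedTetra hx hu.le
  have h2 : ‖x1 - x3 * u‖ ^ 2 ≤ ‖1 - x2 * u‖ ^ 2 := by gcongr
  have hu2 : u.re * u.re + u.im * u.im = 1 := by
    rw [← Complex.normSq_apply, ← Complex.sq_norm, hu, one_pow]
  have hre := congrArg Complex.re hue
  simp only [Complex.mul_re, Complex.sub_re, Complex.sub_im, Complex.mul_im, Complex.conj_re,
    Complex.conj_im, Complex.ofReal_re] at hre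
  rw [← hre]
  simp only [Complex.sq_norm, Complex.normSq_apply, Complex.mul_re, Complex.sub_re, Complex.sub_im,
    Complex.mul_im, Complex.one_re, Complex.one_im] at h2 ⊢
  have e1 : (x3.re * x3.re + x3.im * x3.im) * (u.re * u.re + u.im * u.im) =
      x3.re * x3.re + x3.im * x3.im := by rw [hu2, mul_one]
  have e2 : (x2.re * x2.re + x2.im * x2.im) * (u.re * u.re + u.im * u.im) =
      x2.re * x2.re + x2.im * x2.im := by rw [hu2, mul_one]
  linarith

/-- The norm inequality characterizing points of the closed tetrablock. -/
lemma two_mul_norm_mul_sub_le_of_mem_closedTetra {x1 x2 x3 : ℂ}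
    (hx : (x1, x2, x3) ∈ closedTetra) :
    2 * ‖x1 * x2 - x3‖ ≤ 1 - ‖x1‖ ^ 2 - ‖x2‖ ^ 2 + ‖x3‖ ^ 2 := by
  have hA := two_mul_norm_sub_le_of_mem_closedTetra hx
  have hB := two_mul_norm_sub_le_of_mem_closedTetra (closedTetra.swap hx)
  have h1 : ‖x1‖ ≤ 1 := by simpa using norm_sub_mul_le_of_mem_closedTetra hx (w := 0) (by simp)
  have h2 : ‖x2‖ ≤ 1 := by
    simpa using norm_sub_mul_le_of_mem_closedTetra (closedTetra.swap hx) (w := 0) (by simp)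
  have hA' : ‖x2‖ - ‖x1‖ * ‖x3‖ ≤ ‖x2 - (starRingEnd ℂ) x1 * x3‖ := by
    simpa using norm_sub_norm_le x2 ((starRingEnd ℂ) x1 * x3)
  have hA'' : ‖x1‖ * ‖x3‖ - ‖x2‖ ≤ ‖x2 - (starRingEnd ℂ) x1 * x3‖ := by
    rw [norm_sub_rev]
    simpa using norm_sub_norm_le ((starRingEnd ℂ) x1 * x3) x2
  have hB'' : ‖x2‖ * ‖x3‖ - ‖x1‖ ≤ ‖x1 - (starRingEnd ℂ) x2 * x3‖ := by
    rw [norm_sub_rev]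
    simpa using norm_sub_norm_le ((starRingEnd ℂ) x2 * x3) x1
  have g1 : ‖x1‖ + ‖x3‖ ≤ 1 + ‖x2‖ :=
    abs_le_of_sq_le_sq' (by nlinarith) (by positivity) |>.2
  have g2 : ‖x2‖ + ‖x3‖ ≤ 1 + ‖x1‖ :=
    abs_le_of_sq_le_sq' (by nlinarith) (by positivity) |>.2
  have g3 : ‖x1‖ - ‖x3‖ ≤ 1 - ‖x2‖ :=
    abs_le_of_sq_le_sq' (by nlinarith) (by linarith) |>.2
  have hq : 0 ≤ 1 - ‖x1‖ ^ 2 - ‖x2‖ ^ 2 + ‖x3‖ ^ 2 := by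
    have k1 : (‖x1‖ + ‖x2‖) ^ 2 ≤ (1 + ‖x3‖) ^ 2 :=
      pow_le_pow_left₀ (by positivity) (by linarith) 2
    have k2 : (‖x1‖ - ‖x2‖) ^ 2 ≤ (1 - ‖x3‖) ^ 2 :=
      sq_le_sq' (by linarith) (by linarith)
    nlinarith
  refine abs_le_of_sq_le_sq' ?_ hq |>.2
  have hA2 : (2 * ‖x2 - (starRingEnd ℂ) x1 * x3‖) ^ 2 ≤
      (1 + ‖x2‖ ^ 2 - ‖x1‖ ^ 2 - ‖x3‖ ^ 2) ^ 2 := by gcongr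
  rw [mul_pow] at hA2 ⊢
  simp only [Complex.sq_norm, Complex.normSq_apply, Complex.mul_re, Complex.sub_re, Complex.sub_im,
    Complex.mul_im, Complex.conj_re, Complex.conj_im] at hA2 ⊢
  linarith

lemma isContraction₂_of_mem_closedTetra {x1 x2 x3 b c : ℂ} (hx : (x1, x2, x3) ∈ closedTetra)
    (hbc : b * c = x1 * x2 - x3) (hn : ‖b‖ = ‖c‖) : IsContraction₂ x1 b c x2 := by
  have hq := two_mul_norm_mul_sub_le_of_mem_closedTetra hx
  rw [← hbc, norm_mul, hn] at hq
  have hx3 : x3 = x1 * x2 - b * c := by rw [hbc]; ring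
  have hA := two_mul_norm_sub_le_of_mem_closedTetra hx
  have hB := two_mul_norm_sub_le_of_mem_closedTetra (closedTetra.swap hx)
  have hA0 := norm_nonneg (x2 - (starRingEnd ℂ) x1 * x3)
  have hB0 := norm_nonneg (x1 - (starRingEnd ℂ) x2 * x3)
  set P := 1 - ‖x1‖ ^ 2 - ‖c‖ ^ 2 with hP
  set Q := 1 - ‖x2‖ ^ 2 - ‖b‖ ^ 2 with hQ
  set e := (starRingEnd ℂ) x1 * b + (starRingEnd ℂ) c * x2 with he
  have hdet : P * Q - ‖e‖ ^ 2 =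
      1 - ‖x1‖ ^ 2 - ‖x2‖ ^ 2 - ‖b‖ ^ 2 - ‖c‖ ^ 2 + ‖x1 * x2 - b * c‖ ^ 2 := by
    simp only [hP, hQ, he, Complex.sq_norm, Complex.normSq_apply, Complex.mul_re, Complex.sub_re,
      Complex.sub_im, Complex.add_re, Complex.add_im, Complex.mul_im, Complex.conj_re,
      Complex.conj_im]
    ring
  have hePQ : ‖e‖ ^ 2 ≤ P * Q := by
    rw [← hx3, hn] at hdet
    nlinarith
  have hPQ : 0 ≤ P + Q := by
    rw [hP, hQ, hn]; nlinarith
  have hP0 : 0 ≤ P := by nlinarith [sq_nonneg ‖e‖]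
  have hQ0 : 0 ≤ Q := by nlinarith [sq_nonneg ‖e‖]
  intro s t
  have hexp : ‖s‖ ^ 2 + ‖t‖ ^ 2 - ‖x1 * s + b * t‖ ^ 2 - ‖c * s + x2 * t‖ ^ 2 =
      P * ‖s‖ ^ 2 + Q * ‖t‖ ^ 2 - 2 * ((starRingEnd ℂ) s * t * e).re := by
    simp only [hP, hQ, he, Complex.sq_norm, Complex.normSq_apply, Complex.mul_re,
      Complex.add_re, Complex.add_im, Complex.mul_im, Complex.conj_re, Complex.conj_im]
    ring
  have hre : ((starRingEnd ℂ) s * t * e).re ≤ ‖s‖ * ‖t‖ * ‖e‖ := by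
    refine (Complex.re_le_norm _).trans_eq ?_
    simp
  have hfin : 2 * (‖s‖ * ‖t‖ * ‖e‖) ≤ P * ‖s‖ ^ 2 + Q * ‖t‖ ^ 2 := by
    refine abs_le_of_sq_le_sq' ?_ (by positivity) |>.2
    have : (‖s‖ * ‖t‖) ^ 2 * ‖e‖ ^ 2 ≤ (‖s‖ * ‖t‖) ^ 2 * (P * Q) := by gcongr
    nlinarith [sq_nonneg (P * ‖s‖ ^ 2 - Q * ‖t‖ ^ 2)]
  linarith

section Pick

open Real

lemma sub_ne_zero_of_mem_sphere {μ ζ : ℂ} (hμ : ‖μ‖ < 1) (hζ : ζ ∈ sphere (0 : ℂ) 1) :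
    ζ - μ ≠ 0 := by
  rintro h
  rw [mem_sphere_zero_iff_norm, sub_eq_zero.mp h] at hζ
  exact hμ.ne hζ

lemma star_inv_sub_eq {μ ζ : ℂ} (hμ : ‖μ‖ < 1) (hζ : ζ ∈ sphere (0 : ℂ) 1) :
    star (ζ - μ)⁻¹ = ζ / (1 - star μ * ζ) := by
  have h1 : ‖ζ‖ = 1 := mem_sphere_zero_iff_norm.mp hζ
  have h2 : star ζ * ζ = 1 := by
    simpa [h1] using Complex.conj_mul' ζ
  have h3 : star (ζ - μ) ≠ 0 := star_ne_zero.mpr (sub_ne_zero_of_mem_sphere hμ hζ)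
  have h4 : 1 - star μ * ζ = star (ζ - μ) * ζ := by
    rw [star_sub, sub_mul, h2]
  have h5 : ζ ≠ 0 := by rintro rfl; simp at h1
  rw [h4, star_inv₀]
  field_simp

lemma diffContOnCl_inv_one_sub_mul {μ : ℂ} (hμ : ‖μ‖ < 1) :
    DiffContOnCl ℂ (fun ζ : ℂ => (1 - star μ * ζ)⁻¹) (ball 0 1) := by
  refine DiffContOnCl.inv (Differentiable.diffContOnCl (by fun_prop)) fun ζ hζ => ?_
  rw [closure_ball (0 : ℂ) one_ne_zero, mem_closedBall_zero_iff] at hζ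
  rw [mul_comm]
  exact one_sub_mul_ne_zero hζ (by simpa using hμ)

lemma circleAverage_star_inv_sub_mul_inv_sub {μ ν : ℂ} (hμ : ‖μ‖ < 1) (hν : ‖ν‖ < 1) :
    circleAverage (fun ζ => star (ζ - μ)⁻¹ * (ζ - ν)⁻¹) 0 1 = (1 - star μ * ν)⁻¹ := by
  have h := DiffContOnCl.circleAverage_smul_div (R := 1) (c := (0 : ℂ)) (w := ν)
    (by rw [abs_one]; exact diffContOnCl_inv_one_sub_mul hμ) (by simpa using hν)
  rw [← h]
  refine circleAverage_congr_sphere fun ζ hζ => ?_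
  rw [abs_one] at hζ
  simp only [star_inv_sub_eq hμ hζ, smul_eq_mul, sub_zero]
  ring

lemma circleAverage_star_inv_sub_mul {μ : ℂ} (hμ : ‖μ‖ < 1) {h : ℂ → ℂ}
    (hh : DiffContOnCl ℂ h (ball 0 1)) :
    circleAverage (fun ζ => star (ζ - μ)⁻¹ * h ζ) 0 1 = 0 := by
  have hd : DiffContOnCl ℂ (fun ζ => (ζ * (1 - star μ * ζ)⁻¹) • h ζ) (ball 0 1) :=
    (differentiable_id.diffContOnCl.smul (diffContOnCl_inv_one_sub_mul hμ)).smul hh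
  have h' := DiffContOnCl.circleAverage (R := 1) (c := (0 : ℂ)) (by rw [abs_one]; exact hd)
  rw [zero_mul, zero_smul] at h'
  refine (circleAverage_congr_sphere fun ζ hζ => ?_).trans h'
  rw [abs_one] at hζ
  simp only [star_inv_sub_eq hμ hζ, smul_eq_mul]
  ring

lemma diffContOnCl_dslope {a : ℂ → ℂ} (ha : DiffContOnCl ℂ a (ball 0 1)) {μ : ℂ}
    (hμ : ‖μ‖ < 1) : DiffContOnCl ℂ (dslope a μ) (ball 0 1) := by
  have hn : ball (0 : ℂ) 1 ∈ nhds μ := isOpen_ball.mem_nhds (by simpa using hμ)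
  refine ⟨(Complex.differentiableOn_dslope hn).mpr ha.differentiableOn, ?_⟩
  exact (continuousOn_dslope (Filter.mem_of_superset hn subset_closure)).mpr
    ⟨ha.continuousOn, ha.differentiableOn.differentiableAt hn⟩

/-- Positivity of the Pick kernel of a holomorphic `2 × 2` matrix function that is contractive on
the unit circle. -/
lemma pick_nonneg {a b c d : ℂ → ℂ} (ha : DiffContOnCl ℂ a (ball 0 1))
    (hb : DiffContOnCl ℂ b (ball 0 1)) (hc : DiffContOnCl ℂ c (ball 0 1))
    (hd : DiffContOnCl ℂ d (ball 0 1))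
    (hF : ∀ ζ ∈ sphere (0 : ℂ) 1, IsContraction₂ (a ζ) (b ζ) (c ζ) (d ζ))
    {ι : Type*} [Fintype ι] {μ : ι → ℂ} (hμ : ∀ p, ‖μ p‖ < 1) (s t A C : ι → ℂ)
    (hA : ∀ p, A p = a (μ p) * s p + b (μ p) * t p)
    (hC : ∀ p, C p = c (μ p) * s p + d (μ p) * t p) :
    0 ≤ (∑ p, ∑ q, (star (s p) * s q + star (t p) * t q - star (A p) * A q - star (C p) * C q) *
      (1 - star (μ p) * μ q)⁻¹).re := by
  set k : ι → ι → ℂ := fun p q =>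
    star (s p) * s q + star (t p) * t q - star (A p) * A q - star (C p) * C q with hk
  set h₁ : ℂ → ℂ := fun ζ => ∑ p, (s p * dslope a (μ p) ζ + t p * dslope b (μ p) ζ) with hh₁
  set h₂ : ℂ → ℂ := fun ζ => ∑ p, (s p * dslope c (μ p) ζ + t p * dslope d (μ p) ζ) with hh₂
  have hsum : ∀ f : ι → ℂ → ℂ, (∀ p, DiffContOnCl ℂ (f p) (ball 0 1)) →
      DiffContOnCl ℂ (fun ζ => ∑ p, f p ζ) (ball 0 1) := fun f hf =>
    ⟨DifferentiableOn.fun_sum fun p _ => (hf p).differentiableOn,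
      continuousOn_finsetSum _ fun p _ => (hf p).continuousOn⟩
  have hh₁d : DiffContOnCl ℂ h₁ (ball 0 1) := hsum _ fun p =>
    ((diffContOnCl_dslope ha (hμ p)).const_smul (s p)).add
      ((diffContOnCl_dslope hb (hμ p)).const_smul (t p))
  have hh₂d : DiffContOnCl ℂ h₂ (ball 0 1) := hsum _ fun p =>
    ((diffContOnCl_dslope hc (hμ p)).const_smul (s p)).add
      ((diffContOnCl_dslope hd (hμ p)).const_smul (t p))
  have hfd : ∀ p, DiffContOnCl ℂ (fun ζ => star (A p) * h₁ ζ + star (C p) * h₂ ζ) (ball 0 1) :=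
    fun p => (hh₁d.const_smul (star (A p))).add (hh₂d.const_smul (star (C p)))
  have hcont : ∀ p, ContinuousOn (fun ζ : ℂ => (ζ - μ p)⁻¹) (sphere 0 1) := fun p =>
    ContinuousOn.inv₀ (by fun_prop) fun ζ hζ => sub_ne_zero_of_mem_sphere (hμ p) hζ
  have hci : ∀ f : ℂ → ℂ, ContinuousOn f (sphere 0 1) → CircleIntegrable f 0 1 := fun f hf =>
    hf.circleIntegrable zero_le_one
  have hsub : sphere (0 : ℂ) 1 ⊆ closure (ball 0 1) := by
    rw [closure_ball (0 : ℂ) one_ne_zero]; exact sphere_subset_closedBall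
  have c1 : ∀ p q, ContinuousOn (fun ζ => k p q * (star (ζ - μ p)⁻¹ * (ζ - μ q)⁻¹))
      (sphere (0 : ℂ) 1) := fun p q =>
    continuousOn_const.mul ((continuous_star.comp_continuousOn (hcont p)).mul (hcont q))
  have c2 : ∀ p, ContinuousOn (fun ζ => star (ζ - μ p)⁻¹ *
      (star (A p) * h₁ ζ + star (C p) * h₂ ζ)) (sphere (0 : ℂ) 1) := fun p =>
    (continuous_star.comp_continuousOn (hcont p)).mul ((hfd p).continuousOn.mono hsub)
  have c1' : ContinuousOn (fun ζ => ∑ p, ∑ q, k p q * (star (ζ - μ p)⁻¹ * (ζ - μ q)⁻¹))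
      (sphere (0 : ℂ) 1) :=
    continuousOn_finsetSum _ fun p _ => continuousOn_finsetSum _ fun q _ => c1 p q
  have c2'' : ∀ p, ContinuousOn (fun ζ => 2 * (star (ζ - μ p)⁻¹ *
      (star (A p) * h₁ ζ + star (C p) * h₂ ζ))) (sphere (0 : ℂ) 1) := fun p =>
    continuousOn_const.mul (c2 p)
  have c2' : ContinuousOn (fun ζ => ∑ p, 2 * (star (ζ - μ p)⁻¹ *
      (star (A p) * h₁ ζ + star (C p) * h₂ ζ))) (sphere (0 : ℂ) 1) :=
    continuousOn_finsetSum _ fun p _ => c2'' p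
  set H : ℂ → ℂ := fun ζ => ∑ p, ∑ q, k p q * (star (ζ - μ p)⁻¹ * (ζ - μ q)⁻¹) -
    ∑ p, 2 * (star (ζ - μ p)⁻¹ * (star (A p) * h₁ ζ + star (C p) * h₂ ζ)) with hH
  have hHavg : circleAverage H 0 1 = ∑ p, ∑ q, k p q * (1 - star (μ p) * μ q)⁻¹ := by
    rw [hH, circleAverage_fun_sub (hci _ c1') (hci _ c2'),
      circleAverage_fun_sum fun p _ => hci _ (continuousOn_finsetSum _ fun q _ => c1 p q),
      circleAverage_fun_sum fun p _ => hci _ (c2'' p)]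
    have e2 : ∀ p, circleAverage (fun ζ => 2 * (star (ζ - μ p)⁻¹ *
        (star (A p) * h₁ ζ + star (C p) * h₂ ζ))) 0 1 = 0 := fun p => by
      simp only [← smul_eq_mul (2 : ℂ)]
      rw [circleAverage_fun_smul, circleAverage_star_inv_sub_mul (hμ p) (hfd p), smul_zero]
    rw [Finset.sum_eq_zero fun p _ => e2 p, sub_zero]
    refine Finset.sum_congr rfl fun p _ => ?_
    rw [circleAverage_fun_sum fun q _ => hci _ (c1 p q)]
    refine Finset.sum_congr rfl fun q _ => ?_
    simp only [← smul_eq_mul (k p q)]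
    rw [circleAverage_fun_smul, circleAverage_star_inv_sub_mul_inv_sub (hμ p) (hμ q)]
  have hHpos : ∀ ζ ∈ sphere (0 : ℂ) |1|, 0 ≤ (H ζ).re := by
    intro ζ hζ
    rw [abs_one] at hζ
    have hslope : ∀ (f : ℂ → ℂ) p, dslope f (μ p) ζ = (ζ - μ p)⁻¹ * (f ζ - f (μ p)) := by
      intro f p
      rw [dslope_of_ne _ (sub_ne_zero.mp (sub_ne_zero_of_mem_sphere (hμ p) hζ)), slope_def_module,
        smul_eq_mul]
    set u := ∑ p, s p * (ζ - μ p)⁻¹ with hu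
    set v := ∑ p, t p * (ζ - μ p)⁻¹ with hv
    set e := ∑ p, A p * (ζ - μ p)⁻¹ with he
    set f := ∑ p, C p * (ζ - μ p)⁻¹ with hf
    have r1 : a ζ * u + b ζ * v = e + h₁ ζ := by
      simp only [hu, hv, he, hh₁, Finset.mul_sum, ← Finset.sum_add_distrib, hslope, hA]
      exact Finset.sum_congr rfl fun p _ => by ring
    have r2 : c ζ * u + d ζ * v = f + h₂ ζ := by
      simp only [hu, hv, hf, hh₂, Finset.mul_sum, ← Finset.sum_add_distrib, hslope, hC]
      exact Finset.sum_congr rfl fun p _ => by ring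
    have hHζ : H ζ = star u * u + star v * v - star e * e - star f * f -
        2 * (star e * h₁ ζ + star f * h₂ ζ) := by
      have hprod : ∀ f g : ι → ℂ, star (∑ p, f p * (ζ - μ p)⁻¹) * ∑ q, g q * (ζ - μ q)⁻¹ =
          ∑ p, ∑ q, star (f p) * g q * (star (ζ - μ p)⁻¹ * (ζ - μ q)⁻¹) := by
        intro f g
        rw [star_sum, Finset.sum_mul_sum]
        refine Finset.sum_congr rfl fun p _ => Finset.sum_congr rfl fun q _ => ?_
        rw [star_mul']
        ring
      have hmul : ∀ (f : ι → ℂ) (y : ℂ), star (∑ p, f p * (ζ - μ p)⁻¹) * y =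
          ∑ p, star (ζ - μ p)⁻¹ * (star (f p) * y) := by
        intro f y
        rw [star_sum, Finset.sum_mul]
        refine Finset.sum_congr rfl fun p _ => ?_
        rw [star_mul']
        ring
      simp only [hu, hv, he, hf, hprod]
      simp only [hmul, hH, hk, ← Finset.sum_add_distrib, ← Finset.sum_sub_distrib, sub_mul,
        add_mul, mul_add, Finset.mul_sum]
    have hcon := hF ζ hζ u v
    rw [r1, r2] at hcon
    rw [hHζ]
    simp only [Complex.sq_norm, Complex.normSq_apply, Complex.mul_re, Complex.sub_re,
      Complex.add_re, Complex.add_im, Complex.mul_im, Complex.star_def,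
      Complex.conj_re, Complex.conj_im, Complex.re_ofNat, Complex.im_ofNat] at hcon ⊢
    nlinarith [sq_nonneg (h₁ ζ).re, sq_nonneg (h₁ ζ).im, sq_nonneg (h₂ ζ).re,
      sq_nonneg (h₂ ζ).im]
  have hHc : CircleIntegrable H 0 1 := hci _ (c1'.sub c2')
  have hre := Complex.reCLM.circleAverage_comp_comm hHc
  rw [hHavg] at hre
  simp only [Complex.reCLM_apply] at hre
  rw [← hre]
  exact circleAverage_nonneg_of_nonneg hHpos

end Pick

lemma AnalyticOnNhd.finite_inter_preimage_zero {f : ℂ → ℂ} {K : Set ℂ}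
    (hf : AnalyticOnNhd ℂ f K) (hK : IsCompact K) (hKc : IsConnected K) {x : ℂ} (hx : x ∈ K)
    (hfx : f x ≠ 0) : (K ∩ f ⁻¹' {0}).Finite := by
  have h := codiscreteWithin_iff_locallyFiniteComplementWithin.mp
    (hf.preimage_zero_mem_codiscreteWithin hfx hx hKc)
  have hd : K \ f ⁻¹' {0}ᶜ = K ∩ f ⁻¹' {0} := by ext z; simp
  rw [hd] at h
  choose! t ht htf using h
  obtain ⟨F, hFK, hF⟩ := hK.elim_nhds_subcover t ht
  refine (F.finite_toSet.biUnion fun z hz => htf z (hFK z hz)).subset fun z hz => ?_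
  obtain ⟨w, hw, hzw⟩ := Set.mem_iUnion₂.mp (hF hz.1)
  exact Set.mem_iUnion₂.mpr ⟨w, hw, hzw, hz⟩

/-- A nonvanishing analytic function on the closed unit disc has an analytic square root. -/
lemma AnalyticOnNhd.exists_mul_self_eq {f : ℂ → ℂ} (hf : AnalyticOnNhd ℂ f (closedBall 0 1))
    (h0 : ∀ z ∈ closedBall (0 : ℂ) 1, f z ≠ 0) :
    ∃ u : ℂ → ℂ, AnalyticOnNhd ℂ u (closedBall 0 1) ∧
      ∀ z ∈ closedBall (0 : ℂ) 1, f z = u z * u z := by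
  have hopen : IsOpen {z | AnalyticAt ℂ f z ∧ f z ≠ 0} := by
    rw [isOpen_iff_mem_nhds]
    intro z hz
    filter_upwards [(isOpen_analyticAt ℂ f).mem_nhds hz.1, hz.1.continuousAt.eventually_ne hz.2]
      with w h1 h2 using ⟨h1, h2⟩
  obtain ⟨δ, hδ, hsub⟩ := (isCompact_closedBall (0 : ℂ) 1).exists_thickening_subset_open hopen
    fun z hz => ⟨hf z hz, h0 z hz⟩
  rw [thickening_closedBall hδ zero_le_one] at hsub
  have hcb : closedBall (0 : ℂ) 1 ⊆ ball 0 (δ + 1) := closedBall_subset_ball (by linarith)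
  have hm0 : (0 : ℂ) ∈ ball (0 : ℂ) (δ + 1) := mem_ball_self (by linarith)
  have hdiff : DifferentiableOn ℂ (fun z => deriv f z / f z) (ball 0 (δ + 1)) := fun z hz =>
    ((hsub hz).1.deriv.differentiableAt.div (hsub hz).1.differentiableAt
      (hsub hz).2).differentiableWithinAt
  obtain ⟨g, hg0, hg⟩ := hdiff.isExactOn_ball.with_val_at 0 (Complex.log (f 0))
  have hgd : DifferentiableOn ℂ g (ball 0 (δ + 1)) := fun z hz =>
    (hg z hz).differentiableAt.differentiableWithinAt
  have hga : AnalyticOnNhd ℂ g (ball 0 (δ + 1)) := hgd.analyticOnNhd isOpen_ball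
  have hder : ∀ z ∈ ball (0 : ℂ) (δ + 1), HasDerivAt (fun z => f z * cexp (-g z)) 0 z := by
    intro z hz
    refine ((hsub hz).1.differentiableAt.hasDerivAt.mul (hg z hz).neg.cexp).congr_deriv ?_
    have := (hsub hz).2
    field_simp
    ring
  have hconst : ∀ z ∈ ball (0 : ℂ) (δ + 1), f z = cexp (g z) := by
    intro z hz
    have h := isOpen_ball.is_const_of_deriv_eq_zero (convex_ball (0 : ℂ) (δ + 1)).isPreconnected
      (fun w hw => (hder w hw).differentiableAt.differentiableWithinAt)
      (fun w hw => (hder w hw).deriv) hz hm0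
    simp only [hg0, Complex.exp_neg, Complex.exp_log (hsub hm0).2] at h
    rw [mul_inv_cancel₀ (hsub hm0).2] at h
    exact eq_of_mul_inv_eq_one h
  refine ⟨fun z => cexp (g z / 2), fun z hz => ?_, fun z hz => ?_⟩
  · exact ((hga z (hcb hz)).div analyticAt_const two_ne_zero).cexp
  · rw [← Complex.exp_add, add_halves, hconst z (hcb hz)]

lemma AnalyticOnNhd.exists_eq_sub_pow_mul {f : ℂ → ℂ} {U : Set ℂ} (hf : AnalyticOnNhd ℂ f U)
    (hU : IsPreconnected U) {a b : ℂ} (ha : a ∈ U) (hb : b ∈ U) (hfb : f b ≠ 0) :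
    ∃ (n : ℕ) (g : ℂ → ℂ), AnalyticOnNhd ℂ g U ∧ g a ≠ 0 ∧
      ∀ z ∈ U, f z = (z - a) ^ n * g z := by
  have hne : ¬∀ᶠ z in nhds a, f z = 0 := fun h =>
    hfb (hf.eqOn_zero_of_preconnected_of_eventuallyEq_zero hU ha h hb)
  obtain ⟨n, g₀, hg₀, hg₀a, hfg⟩ := (hf a ha).exists_eventuallyEq_pow_smul_nonzero_iff.mpr hne
  simp only [smul_eq_mul] at hfg
  classical
  refine ⟨n, Function.update (fun z => f z / (z - a) ^ n) a (g₀ a), fun z hz => ?_, by simpa,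
    fun z _ => ?_⟩
  · by_cases hza : z = a
    · subst hza
      refine hg₀.congr ?_
      filter_upwards [hfg] with w hw
      by_cases hwz : w = z
      · simp [hwz]
      · rw [Function.update_of_ne hwz, hw,
          mul_div_cancel_left₀ _ (pow_ne_zero _ (sub_ne_zero.mpr hwz))]
    · have h1 : AnalyticAt ℂ (fun z => f z / (z - a) ^ n) z :=
        (hf z hz).div (by fun_prop) (pow_ne_zero _ (sub_ne_zero.mpr hza))
      refine h1.congr ?_
      filter_upwards [isOpen_ne.mem_nhds hza] with w hw
      rw [Function.update_of_ne hw]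
  · by_cases hza : z = a
    · subst hza
      simpa using hfg.self_of_nhds
    · rw [Function.update_of_ne hza, mul_div_cancel₀ _ (pow_ne_zero _ (sub_ne_zero.mpr hza))]

lemma exists_factorization_of_zeros_subset (S : Finset ℂ) (hS : ∀ a ∈ S, ‖a‖ < 1) :
    ∀ f : ℂ → ℂ, AnalyticOnNhd ℂ f (closedBall 0 1) →
      (∀ z ∈ closedBall (0 : ℂ) 1, f z = 0 → z ∈ S) →
      ∃ u v : ℂ → ℂ, AnalyticOnNhd ℂ u (closedBall 0 1) ∧ AnalyticOnNhd ℂ v (closedBall 0 1) ∧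
        (∀ z ∈ closedBall (0 : ℂ) 1, f z = u z * v z) ∧
        ∀ z ∈ sphere (0 : ℂ) 1, ‖u z‖ = ‖v z‖ := by
  induction S using Finset.induction_on with
  | empty =>
    intro f hf h0
    obtain ⟨u, hu, hfu⟩ := hf.exists_mul_self_eq fun z hz h => Finset.notMem_empty _ (h0 z hz h)
    exact ⟨u, u, hu, hu, hfu, fun _ _ => rfl⟩
  | insert a S _ ih =>
    intro f hf h0
    have ha : ‖a‖ < 1 := hS a (Finset.mem_insert_self _ _)
    have h1 : (1 : ℂ) ∈ closedBall (0 : ℂ) 1 := by simp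
    obtain ⟨n, g, hg, hga, hfg⟩ := hf.exists_eq_sub_pow_mul
      (convex_closedBall (0 : ℂ) 1).isPreconnected (a := a) (b := 1) (by simpa using ha.le) h1
      fun h => by simpa using hS 1 (h0 1 h1 h)
    have hden : ∀ z ∈ closedBall (0 : ℂ) 1, 1 - star a * z ≠ 0 := by
      intro z hz
      rw [mul_comm]
      exact one_sub_mul_ne_zero (by simpa using hz) (by simpa using ha)
    obtain ⟨u, v, hu, hv, huv, hn⟩ := ih (fun b hb => hS b (Finset.mem_insert_of_mem hb))
      (fun z => g z * (1 - star a * z) ^ n) (fun z hz => (hg z hz).mul (by fun_prop)) (by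
        intro z hz h
        have hgz : g z = 0 := (mul_eq_zero.mp h).resolve_right (pow_ne_zero _ (hden z hz))
        have hza : z ≠ a := fun h' => hga (h' ▸ hgz)
        exact (Finset.mem_insert.mp (h0 z hz (by rw [hfg z hz, hgz, mul_zero]))).resolve_left hza)
    refine ⟨fun z => ((z - a) / (1 - star a * z)) ^ n * u z, v, fun z hz => ?_, hv,
      fun z hz => ?_, fun z hz => ?_⟩
    · have hq : AnalyticAt ℂ (fun z => (z - a) / (1 - star a * z)) z :=
        AnalyticAt.div (by fun_prop) (by fun_prop) (hden z hz)
      exact (hq.pow n).mul (hu z hz)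
    · rw [hfg z hz, mul_assoc, ← huv z hz, div_pow, div_mul_eq_mul_div,
        eq_div_iff (pow_ne_zero n (hden z hz))]
      ring
    · have hzn : ‖z‖ = 1 := mem_sphere_zero_iff_norm.mp hz
      have hd := hden z (sphere_subset_closedBall hz)
      have he : ‖z - a‖ = ‖1 - star a * z‖ := by
        have hs : star (z - a) * z = 1 - star a * z := by
          have : star z * z = 1 := by simpa [hzn] using Complex.conj_mul' z
          rw [star_sub, sub_mul, this]
        rw [← hs, norm_mul, norm_star, hzn, mul_one]
      rw [norm_mul, norm_pow, norm_div, he, div_self (norm_ne_zero_iff.mpr hd), one_pow, one_mul,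
        hn z hz]

/-- Factorization into two factors whose moduli agree on the unit circle. -/
lemma AnalyticOnNhd.exists_factorization {f : ℂ → ℂ} (hf : AnalyticOnNhd ℂ f (closedBall 0 1))
    (h0 : ∀ z ∈ sphere (0 : ℂ) 1, f z ≠ 0) :
    ∃ u v : ℂ → ℂ, AnalyticOnNhd ℂ u (closedBall 0 1) ∧ AnalyticOnNhd ℂ v (closedBall 0 1) ∧
      (∀ z ∈ closedBall (0 : ℂ) 1, f z = u z * v z) ∧
      ∀ z ∈ sphere (0 : ℂ) 1, ‖u z‖ = ‖v z‖ := by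
  have hfin := hf.finite_inter_preimage_zero (isCompact_closedBall 0 1)
    ((convex_closedBall (0 : ℂ) 1).isConnected ⟨0, by simp⟩) (x := 1) (by simp)
    (h0 1 (by simp))
  refine exists_factorization_of_zeros_subset hfin.toFinset (fun a ha => ?_) f hf fun z hz h =>
    hfin.mem_toFinset.mpr ⟨hz, h⟩
  obtain ⟨ha1, ha2⟩ := hfin.mem_toFinset.mp ha
  refine lt_of_le_of_ne (by simpa using ha1) fun h => h0 a (by simpa using h) ha2

/-- The function `Ψ(z, x) = (z x₃ - x₁) / (x₂ z - 1)`. -/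
def tetraFrac (y : ℂ × ℂ × ℂ) (z : ℂ) : ℂ := (z * y.2.2 - y.1) / (y.2.1 * z - 1)

/-- The kernel completing `star γ * γ`, with `γ = g / (1 - x₂ z)`, to a solution of the
interpolation identity at the nodes `√σ • lam`. -/
def interpolationKernel {ι κ : Type*} (y : ι → ℂ × ℂ × ℂ) (lam : ι → ℂ) (zs : κ → ℂ)
    (g : ι → ℂ) (σ : ℂ) : Matrix (ι × κ) (ι × κ) ℂ :=
  Matrix.of fun p q =>
    (1 - star (tetraFrac (y p.1) (zs p.2)) * tetraFrac (y q.1) (zs q.2) -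
      (1 - star (zs p.2) * zs q.2) * (star (g p.1 / (1 - (y p.1).2.1 * zs p.2)) *
        (g q.1 / (1 - (y q.1).2.1 * zs q.2)))) * (1 - σ * (star (lam p.1) * lam q.1))⁻¹

lemma exists_interpolationKernel_nonneg_of_ne_zero {ι κ : Type*} [Fintype ι] [Fintype κ]
    {x : ℂ → ℂ × ℂ × ℂ} (hx : HolDiscTetra x) {lam : ι → ℂ} {zs : κ → ℂ}
    (hzs : ∀ k, zs k ∈ uDisc) {R : ℝ} (hR0 : 0 < R) (hR1 : R < 1) (hlam : ∀ j, ‖lam j‖ < R)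
    (hP : ∀ z : ℂ, ‖z‖ = R → (x z).1 * (x z).2.1 - (x z).2.2 ≠ 0) :
    ∃ g : ι → ℂ, (∀ j, ‖g j‖ ≤ 1) ∧ ∀ w : ι × κ → ℂ,
      0 ≤ (∑ p, ∑ q, star (w p) *
        interpolationKernel (fun j => x (lam j)) lam zs g ((R⁻¹ ^ 2 : ℝ) : ℂ) p q * w q).re := by
  have hRc : (R : ℂ) ≠ 0 := by exact_mod_cast hR0.ne'
  have hmem : ∀ z ∈ closedBall (0 : ℂ) 1, (R : ℂ) * z ∈ uDisc := by
    intro z hz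
    rw [mem_uDisc, norm_mul, Complex.norm_real, Real.norm_of_nonneg hR0.le]
    rw [mem_closedBall_zero_iff] at hz
    nlinarith
  have hy : AnalyticOnNhd ℂ (fun z => x (R * z)) (closedBall 0 1) := fun z hz =>
    (hx.1 _ (hmem z hz)).comp (f := fun z => (R : ℂ) * z) (by fun_prop)
  have hy1 : AnalyticOnNhd ℂ (fun z => (x (R * z)).1) (closedBall 0 1) := fun z hz =>
    analyticAt_fst.comp (hy z hz)
  have hy2 : AnalyticOnNhd ℂ (fun z => (x (R * z)).2.1) (closedBall 0 1) := fun z hz =>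
    analyticAt_fst.comp (analyticAt_snd.comp (hy z hz))
  have hy3 : AnalyticOnNhd ℂ (fun z => (x (R * z)).2.2) (closedBall 0 1) := fun z hz =>
    analyticAt_snd.comp (analyticAt_snd.comp (hy z hz))
  obtain ⟨b, c, hb, hc, hbc, hn⟩ := ((hy1.mul hy2).sub hy3).exists_factorization
    fun z hz => hP _ (by
      rw [norm_mul, Complex.norm_real, Real.norm_of_nonneg hR0.le, mem_sphere_zero_iff_norm.mp hz,
        mul_one])
  have hF : ∀ z ∈ sphere (0 : ℂ) 1,
      IsContraction₂ (x (R * z)).1 (b z) (c z) (x (R * z)).2.1 := fun z hz =>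
    isContraction₂_of_mem_closedTetra (hx.2 _ (hmem z (sphere_subset_closedBall hz)))
      (hbc z (sphere_subset_closedBall hz)).symm (hn z hz)
  have hdc : ∀ {f : ℂ → ℂ}, AnalyticOnNhd ℂ f (closedBall 0 1) → DiffContOnCl ℂ f (ball 0 1) :=
    fun hf => DifferentiableOn.diffContOnCl (by
      rw [closure_ball (0 : ℂ) one_ne_zero]; exact hf.differentiableOn)
  have hμ : ∀ j, ‖lam j / R‖ < 1 := fun j => by
    rw [norm_div, Complex.norm_real, Real.norm_of_nonneg hR0.le, div_lt_one hR0]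
    exact hlam j
  have hμc : ∀ j, lam j / R ∈ closedBall (0 : ℂ) 1 := fun j => by simpa using (hμ j).le
  have hRμ : ∀ j, R * (lam j / R) = lam j := fun j => mul_div_cancel₀ _ hRc
  have hlamD : ∀ j, lam j ∈ uDisc := fun j => hRμ j ▸ hmem _ (hμc j)
  refine ⟨fun j => c (lam j / R), fun j => ?_, fun w => ?_⟩
  · refine Complex.norm_le_of_forall_mem_frontier_norm_le isBounded_ball (hdc hc) (fun z hz => ?_)
      (by rw [closure_ball (0 : ℂ) one_ne_zero]; exact hμc j)
    rw [frontier_ball (0 : ℂ) one_ne_zero] at hz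
    have := (hF z hz).norm_left_sq_add_le
    nlinarith [sq_nonneg ‖(x (R * z)).1‖, norm_nonneg (c z)]
  · have hden : ∀ p : ι × κ, 1 - (x (lam p.1)).2.1 * zs p.2 ≠ 0 := fun p =>
      closedTetra.one_sub_mul_ne_zero (hx.2 _ (hlamD p.1)) (hzs p.2)
    have hden' : ∀ p : ι × κ, (x (lam p.1)).2.1 * zs p.2 - 1 ≠ 0 := fun p => by
      rw [← neg_ne_zero, neg_sub]; exact hden p
    have hpick := pick_nonneg (hdc hy1) (hdc hb) (hdc hc) (hdc hy2) hF
      (μ := fun p : ι × κ => lam p.1 / R) (fun p => hμ p.1) w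
      (fun p => zs p.2 * (c (lam p.1 / R) / (1 - (x (lam p.1)).2.1 * zs p.2)) * w p)
      (fun p => tetraFrac (x (lam p.1)) (zs p.2) * w p)
      (fun p => c (lam p.1 / R) / (1 - (x (lam p.1)).2.1 * zs p.2) * w p)
      (fun p => by
        have h1 := hbc _ (hμc p.1)
        have h2 := hden p
        simp only [Pi.sub_apply, hRμ] at h1 ⊢
        have h4 : tetraFrac (x (lam p.1)) (zs p.2) * ((x (lam p.1)).2.1 * zs p.2 - 1) =
            zs p.2 * (x (lam p.1)).2.2 - (x (lam p.1)).1 := div_mul_cancel₀ _ (hden' p)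
        have h5 := div_mul_cancel₀ (c (lam p.1 / R)) h2
        refine mul_right_cancel₀ h2 ?_
        linear_combination (-(w p)) * h4 + (w p * zs p.2) * h1 -
          (b (lam p.1 / R) * w p * zs p.2) * h5)
      (fun p => by
        have h2 := hden p
        simp only [hRμ]
        field_simp
        ring)
    refine hpick.trans_eq (congrArg Complex.re ?_)
    refine Finset.sum_congr rfl fun p _ => Finset.sum_congr rfl fun q _ => ?_
    have hσ : star (lam p.1 / (R : ℂ)) * (lam q.1 / R) =
        ((R⁻¹ ^ 2 : ℝ) : ℂ) * (star (lam p.1) * lam q.1) := by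
      simp only [star_div₀, Complex.star_def, Complex.conj_ofReal]
      push_cast
      field_simp
    simp only [interpolationKernel, of_apply, hσ, star_mul']
    ring

lemma AnalyticOnNhd.exists_radius_ne_zero {f : ℂ → ℂ} (hf : AnalyticOnNhd ℂ f (ball 0 1))
    {a : ℂ} (ha : f a ≠ 0) {r : ℝ} (har : ‖a‖ ≤ r) (hr1 : r < 1) :
    ∃ R, r < R ∧ R < 1 ∧ ∀ z : ℂ, ‖z‖ = R → f z ≠ 0 := by
  obtain ⟨r', hr, hr'⟩ := exists_between hr1
  have har' : ‖a‖ ≤ r' := har.trans hr.le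
  have hfin := (hf.mono (closedBall_subset_ball hr')).finite_inter_preimage_zero
    (isCompact_closedBall 0 r') ((convex_closedBall (0 : ℂ) r').isConnected
      ⟨a, by simpa using har'⟩) (x := a) (by simpa using har') ha
  obtain ⟨R, hR, hRn⟩ := (Set.Ioo_infinite hr).exists_notMem_finite (hfin.image norm)
  refine ⟨R, hR.1, hR.2.trans hr', fun z hz h => hRn ⟨z, ⟨?_, h⟩, hz⟩⟩
  simpa [hz] using hR.2.le

lemma exists_interpolationKernel_nonneg {ι κ : Type*} [Fintype ι] [Fintype κ] [Nonempty ι]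
    {x : ℂ → ℂ × ℂ × ℂ} (hx : HolDiscTetra x) {lam : ι → ℂ} (hlam : ∀ j, lam j ∈ uDisc)
    (hne : ∀ j, (x (lam j)).1 * (x (lam j)).2.1 ≠ (x (lam j)).2.2) {zs : κ → ℂ}
    (hzs : ∀ k, zs k ∈ uDisc) :
    ∃ g : ι → ℂ, ∀ w : ι × κ → ℂ,
      0 ≤ (∑ p, ∑ q, star (w p) *
        interpolationKernel (fun j => x (lam j)) lam zs g 1 p q * w q).re := by
  simp only [mem_uDisc] at hlam
  have hP : AnalyticOnNhd ℂ (fun z => (x z).1 * (x z).2.1 - (x z).2.2) (ball 0 1) := fun z hz =>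
    ((analyticAt_fst.comp (hx.1 z hz)).mul
      (analyticAt_fst.comp (analyticAt_snd.comp (hx.1 z hz)))).sub
      (analyticAt_snd.comp (analyticAt_snd.comp (hx.1 z hz)))
  obtain ⟨ρ, hρ, hρ1⟩ : ∃ ρ : ℝ, (∀ j, ‖lam j‖ ≤ ρ) ∧ ρ < 1 := by
    obtain ⟨i, hi⟩ := Finite.exists_max fun j => ‖lam j‖
    exact ⟨_, hi, hlam i⟩
  obtain ⟨r, -, hr1, hr⟩ := exists_seq_strictMono_tendsto' hρ1
  obtain ⟨i⟩ := ‹Nonempty ι›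
  have hρ0 : 0 ≤ ρ := (norm_nonneg _).trans (hρ i)
  choose R hrR hR1 hRP using fun m : ℕ => hP.exists_radius_ne_zero (sub_ne_zero.mpr (hne i))
    ((hρ i).trans (hr1 m).1.le) (hr1 m).2
  have hρR : ∀ m, ρ < R m := fun m => (hr1 m).1.trans (hrR m)
  have hRt : Filter.Tendsto R Filter.atTop (nhds 1) :=
    tendsto_of_tendsto_of_tendsto_of_le_of_le hr tendsto_const_nhds (fun m => (hrR m).le)
      fun m => (hR1 m).le
  choose g hg hgk using fun m => exists_interpolationKernel_nonneg_of_ne_zero hx hzs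
    (hρ0.trans_lt (hρR m)) (hR1 m) (fun j => (hρ j).trans_lt (hρR m)) (hRP m)
  obtain ⟨G, -, φ, hφ, hG⟩ := (isCompact_closedBall (0 : ι → ℂ) 1).tendsto_subseq (x := g)
    fun m => by simpa [pi_norm_le_iff_of_nonneg] using hg m
  refine ⟨G, fun w => ge_of_tendsto' (x := Filter.atTop) ?_ fun m => hgk (φ m) w⟩
  have hσ : Filter.Tendsto (fun m => (((R (φ m))⁻¹ ^ 2 : ℝ) : ℂ)) Filter.atTop (nhds 1) := by
    have h := ((hRt.comp hφ.tendsto_atTop).inv₀ one_ne_zero).pow 2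
    rw [inv_one, one_pow] at h
    have h1 := Complex.continuous_ofReal.tendsto 1
    rw [Complex.ofReal_one] at h1
    exact h1.comp h
  have hG' : ∀ j, Filter.Tendsto (fun m => g (φ m) j) Filter.atTop (nhds (G j)) :=
    tendsto_pi_nhds.mp hG
  refine (Complex.continuous_re.tendsto _).comp (tendsto_finsetSum _ fun p _ =>
    tendsto_finsetSum _ fun q _ => (Filter.Tendsto.const_mul _ ?_).mul_const _)
  simp only [interpolationKernel, of_apply]
  refine (tendsto_const_nhds.sub (tendsto_const_nhds.mul (Filter.Tendsto.mul ?_ ?_))).mul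
    (Filter.Tendsto.inv₀ (tendsto_const_nhds.sub (hσ.mul_const _)) ?_)
  · exact (continuous_star.tendsto _).comp ((hG' p.1).div_const _)
  · exact (hG' q.1).div_const _
  · rw [one_mul]
    exact one_sub_mul_ne_zero (by simpa using (hlam p.1).le) (hlam q.1)

lemma interpolationKernel_posSemidef {ι κ : Type*} [Fintype ι] [Fintype κ]
    {y : ι → ℂ × ℂ × ℂ} {lam : ι → ℂ} {zs : κ → ℂ} {g : ι → ℂ}
    (h : ∀ w : ι × κ → ℂ, 0 ≤ (∑ p, ∑ q, star (w p) *
      interpolationKernel y lam zs g 1 p q * w q).re) :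
    (interpolationKernel y lam zs g 1).PosSemidef := by
  have hH : (interpolationKernel y lam zs g 1).IsHermitian := by
    ext p q
    simp only [interpolationKernel, conjTranspose_apply, of_apply, star_mul', star_sub, star_one,
      star_star, star_inv₀, star_div₀]
    ring
  refine Matrix.PosSemidef.of_dotProduct_mulVec_nonneg hH fun w => ?_
  rw [Complex.nonneg_iff]
  refine ⟨by rw [star_dotProduct_mulVec_eq_sum]; exact h w, ?_⟩
  exact (hH.im_star_dotProduct_mulVec_self w).symm

lemma exists_posSemidef_of_holDiscTetra {n : ℕ} {lam : Fin n → ℂ} (hlam : ∀ j, lam j ∈ uDisc)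
    {x : ℂ → ℂ × ℂ × ℂ} (hx : HolDiscTetra x)
    (hne : ∀ j, (x (lam j)).1 * (x (lam j)).2.1 ≠ (x (lam j)).2.2) {zs : Fin 3 → ℂ}
    (hzs : ∀ k, zs k ∈ uDisc) :
    ∃ N M : Matrix (Fin n × Fin 3) (Fin n × Fin 3) ℂ,
      N.PosSemidef ∧ N.rank ≤ 1 ∧ M.PosSemidef ∧
      ∀ p q : Fin n × Fin 3,
        1 - star (tetraFrac (x (lam p.1)) (zs p.2)) * tetraFrac (x (lam q.1)) (zs q.2) =
          (1 - star (zs p.2) * zs q.2) * N p q + (1 - star (lam p.1) * lam q.1) * M p q := by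
  rcases isEmpty_or_nonempty (Fin n) with _ | _
  · exact ⟨0, 0, PosSemidef.zero, by simp, PosSemidef.zero, fun p => isEmptyElim p.1⟩
  obtain ⟨g, hg⟩ := exists_interpolationKernel_nonneg hx hlam hne hzs
  let γ : Fin n × Fin 3 → ℂ := fun p => g p.1 / (1 - (x (lam p.1)).2.1 * zs p.2)
  refine ⟨vecMulVec (star γ) γ, _, ?_, rank_vecMulVec_le _ _,
    interpolationKernel_posSemidef hg, fun p q => ?_⟩
  · simpa using posSemidef_vecMulVec_star_self γ
  · have hd : 1 - star (lam p.1) * lam q.1 ≠ 0 :=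
      one_sub_mul_ne_zero (by simpa using (mem_uDisc.mp (hlam p.1)).le) (mem_uDisc.mp (hlam q.1))
    simp only [interpolationKernel, of_apply, vecMulVec_apply, Pi.star_apply, one_mul, γ]
    rw [mul_comm _ (_ * _⁻¹), inv_mul_cancel_right₀ hd]
    ring

lemma exists_injective_fin_three_uDisc :
    ∃ zs : Fin 3 → ℂ, (∀ k, zs k ∈ uDisc) ∧ Function.Injective zs := by
  refine ⟨fun k => ((k : ℕ) : ℂ) / 4, fun k => ?_, fun i j h => ?_⟩
  · rw [mem_uDisc, norm_div, Complex.norm_natCast, Complex.norm_ofNat, div_lt_one (by norm_num)]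
    have := k.isLt
    exact_mod_cast this.trans (by norm_num)
  · rw [div_left_inj' (by norm_num), Nat.cast_inj] at h
    exact Fin.ext h

/-- Theorem 9.1 (parts (i), (iii), (iv)): solvability criterion for the
interpolation problem into the closed tetrablock. -/
theorem tetra_interpolation_criterion (n : ℕ)
    (lam : Fin n → ℂ) (hlam : ∀ j, lam j ∈ uDisc) (hdist : Function.Injective lam)
    (x1 x2 x3 : Fin n → ℂ)
    (hE : ∀ j, (x1 j, x2 j, x3 j) ∈ closedTetra)
    (hne : ∀ j, x1 j * x2 j ≠ x3 j) :
    ((∃ x : ℂ → ℂ × ℂ × ℂ, HolDiscTetra x ∧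
        ∀ j, x (lam j) = (x1 j, x2 j, x3 j)) ↔
      (∀ zs : Fin 3 → ℂ, (∀ k, zs k ∈ uDisc) → Function.Injective zs →
        ∃ N M : Matrix (Fin n × Fin 3) (Fin n × Fin 3) ℂ,
          N.PosSemidef ∧ N.rank ≤ 1 ∧ M.PosSemidef ∧
          ∀ p q : Fin n × Fin 3,
            1 - star ((zs p.2 * x3 p.1 - x1 p.1) / (x2 p.1 * zs p.2 - 1)) *
                  ((zs q.2 * x3 q.1 - x1 q.1) / (x2 q.1 * zs q.2 - 1)) =
              (1 - star (zs p.2) * zs q.2) * N p q +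
                (1 - star (lam p.1) * lam q.1) * M p q)) ∧
    ((∃ x : ℂ → ℂ × ℂ × ℂ, HolDiscTetra x ∧
        ∀ j, x (lam j) = (x1 j, x2 j, x3 j)) ↔
      (∃ zs : Fin 3 → ℂ, (∀ k, zs k ∈ uDisc) ∧ Function.Injective zs ∧
        ∃ N M : Matrix (Fin n × Fin 3) (Fin n × Fin 3) ℂ,
          N.PosSemidef ∧ N.rank ≤ 1 ∧ M.PosSemidef ∧
          (Matrix.of fun p q : Fin n × Fin 3 =>
            1 - star ((zs p.2 * x3 p.1 - x1 p.1) / (x2 p.1 * zs p.2 - 1)) *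
                  ((zs q.2 * x3 q.1 - x1 q.1) / (x2 q.1 * zs q.2 - 1)) -
              (1 - star (zs p.2) * zs q.2) * N p q -
                (1 - star (lam p.1) * lam q.1) * M p q).PosSemidef)) := by
  have hforward : ∀ x : ℂ → ℂ × ℂ × ℂ, HolDiscTetra x →
      (∀ j, x (lam j) = (x1 j, x2 j, x3 j)) → ∀ zs : Fin 3 → ℂ, (∀ k, zs k ∈ uDisc) →
        ∃ N M : Matrix (Fin n × Fin 3) (Fin n × Fin 3) ℂ,
          N.PosSemidef ∧ N.rank ≤ 1 ∧ M.PosSemidef ∧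
          ∀ p q : Fin n × Fin 3,
            1 - star ((zs p.2 * x3 p.1 - x1 p.1) / (x2 p.1 * zs p.2 - 1)) *
                  ((zs q.2 * x3 q.1 - x1 q.1) / (x2 q.1 * zs q.2 - 1)) =
              (1 - star (zs p.2) * zs q.2) * N p q +
                (1 - star (lam p.1) * lam q.1) * M p q := by
    intro x hx hxj zs hzs
    have h := exists_posSemidef_of_holDiscTetra hlam hx
      (fun j => by rw [hxj j]; exact hne j) hzs
    simpa only [tetraFrac, hxj] using h
  refine ⟨⟨fun ⟨x, hx, hxj⟩ zs hzs _ => hforward x hx hxj zs hzs, fun h => ?_⟩,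
    fun ⟨x, hx, hxj⟩ => ?_, fun ⟨zs, hzs, hinj, N, M, hN, hr, hM, hP⟩ =>
      exists_interpolant_of_posSemidef hlam hE hne hzs hinj hN hr hM hP⟩
  · obtain ⟨zs, hzs, hinj⟩ := exists_injective_fin_three_uDisc
    obtain ⟨N, M, hN, hr, hM, hNM⟩ := h zs hzs hinj
    refine exists_interpolant_of_posSemidef hlam hE hne hzs hinj hN hr hM ?_
    convert PosSemidef.zero using 1
    ext p q
    rw [of_apply, hNM p q, Matrix.zero_apply]
    ring
  · obtain ⟨zs, hzs, hinj⟩ := exists_injective_fin_three_uDisc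
    obtain ⟨N, M, hN, hr, hM, hNM⟩ := hforward x hx hxj zs hzs
    refine ⟨zs, hzs, hinj, N, M, hN, hr, hM, ?_⟩
    convert PosSemidef.zero using 1
    ext p q
    rw [of_apply, hNM p q, Matrix.zero_apply]
    ring

end
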